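/- Let m,n ≥ 1 and let μ ⊆ m^n be a nonempty partition. Then the rational function (u−[v⁻])·T_{μ*μ̄}(u) is defined at u = [v⁻], and its value there (i.e., the residue of T_{μ*μ̄} at u = [v⁻]) equals (∏_{b∈μ} [b̄] / ∏_{b∈μ, b≠(0,0)} [b]) · ∏_{b∈μ̄} lh_{μ̄}(b)/lh_{m^n}(b̌) · ∏_{b∈μ} uh_{μ}(b)/uh_{m^n}(b̂). -/

import Mathlib

/-!
Common setup: boxes, Young diagrams as finite lower sets of boxes (French notation),
arms, legs, hooks, the field `ℚ(α)`, rational functions in `u` over `ℚ(α)`,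
the functions `T_Γ`, corners, star products, rectangles and complements.
-/

open scoped BigOperators

attribute [local instance] Classical.propDecidable

namespace JackLR

/-- A box `(x, y)`: `x` is the column index, `y` the row index (French notation). -/
abbrev Box := ℕ × ℕ

/-- The field `ℚ(α)`. -/
abbrev K := RatFunc ℚ

/-- Rational functions in a variable `u` with coefficients in `ℚ(α)`. -/
abbrev F := RatFunc K

/-- The indeterminate `α`. -/
noncomputable def alpha : K := RatFunc.X

/-- `[c] := α·x − y` for `c = (x, y) ∈ ℤ²`. -/
noncomputable def brk (c : ℤ × ℤ) : K := alpha * (c.1 : K) - (c.2 : K)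

/-- The embedding of a box into `ℤ²`. -/
def zb (b : Box) : ℤ × ℤ := ((b.1 : ℤ), (b.2 : ℤ))

/-- `[b]` for a box `b`. -/
noncomputable def brkN (b : Box) : K := brk (zb b)

/-- `S` is the set of boxes of a Young diagram (equivalently, of a partition). -/
def IsYoung (S : Finset Box) : Prop := IsLowerSet (↑S : Set Box)

/-- The arm of `s`: number of boxes of `S` strictly to the right of `s` in its row. -/
def arm (S : Finset Box) (s : Box) : ℕ := (S.filter fun b => b.2 = s.2 ∧ s.1 < b.1).card

/-- The leg of `s`: number of boxes of `S` strictly above `s` in its column. -/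
def leg (S : Finset Box) (s : Box) : ℕ := (S.filter fun b => b.1 = s.1 ∧ s.2 < b.2).card

/-- Upper hook vector `h⁺_S(s) = (arm+1, −leg)`. -/
def hup (S : Finset Box) (s : Box) : ℤ × ℤ := ((arm S s : ℤ) + 1, -(leg S s : ℤ))

/-- Lower hook vector `h⁻_S(s) = (arm, −leg−1)`. -/
def hlo (S : Finset Box) (s : Box) : ℤ × ℤ := ((arm S s : ℤ), -((leg S s : ℤ) + 1))

/-- Upper hook value `uh_S(s) = α(arm+1) + leg`. -/
noncomputable def uh (S : Finset Box) (s : Box) : K := brk (hup S s)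

/-- Lower hook value `lh_S(s) = α·arm + leg + 1`. -/
noncomputable def lh (S : Finset Box) (s : Box) : K := brk (hlo S s)

/-- The variable `u`. -/
noncomputable def uu : F := RatFunc.X

/-- `T_□(w) = (w−[0,0])(w−[1,1]) / ((w−[1,0])(w−[0,1]))`. -/
noncomputable def Tbox (w : F) : F :=
  ((w - RatFunc.C (brk (0, 0))) * (w - RatFunc.C (brk (1, 1)))) /
    ((w - RatFunc.C (brk (1, 0))) * (w - RatFunc.C (brk (0, 1))))

/-- `T_Γ` with the variable `u` replaced by `w`. -/
noncomputable def TMat (Γ : Multiset Box) (w : F) : F :=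
  (Γ.map fun b => Tbox (w - RatFunc.C (brkN b))).prod

/-- `T_Γ(u) = ∏_{b ∈ Γ} T_□(u − [b])` for a finite multiset `Γ` of boxes. -/
noncomputable def TM (Γ : Multiset Box) : F := TMat Γ uu

/-- `T_S(u)` for a finite set `S` of boxes. -/
noncomputable def TS (S : Finset Box) : F := TM S.val

/-- The star product `μ * ν` as the multiset `{s + t : s ∈ μ, t ∈ ν}` with multiplicity. -/
def star (μ ν : Finset Box) : Multiset Box :=
  μ.val.bind fun s => ν.val.map fun t => (s.1 + t.1, s.2 + t.2)

/-- The rectangular partition `m^n` (n rows of length m). -/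
def rect (m n : ℕ) : Finset Box := Finset.range m ×ˢ Finset.range n

/-- `v⁻ = (m−1, n−1)`. -/
def vminus (m n : ℕ) : Box := (m - 1, n - 1)

/-- `b̄ := v⁻ − b`. -/
def conjBox (m n : ℕ) (b : Box) : Box := (m - 1 - b.1, n - 1 - b.2)

/-- The complement partition of `μ ⊆ m^n` inside `m^n`, with boxes `{v⁻ − b : b ∈ m^n, b ∉ μ}`. -/
def complIn (m n : ℕ) (μ : Finset Box) : Finset Box := (rect m n \ μ).image (conjBox m n)

/-- `b̂ := (m−1−b₁, b₂)`. -/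
def hflip (m : ℕ) (b : Box) : Box := (m - 1 - b.1, b.2)

/-- `b̌ := (b₁, n−1−b₂)`. -/
def vflip (n : ℕ) (b : Box) : Box := (b.1, n - 1 - b.2)

/-- Inner corners `I_S`: removable boxes. -/
def Inner (S : Finset Box) : Finset Box :=
  S.filter fun s => (s.1 + 1, s.2) ∉ S ∧ (s.1, s.2 + 1) ∉ S

/-- `t` can be added to `S` to give again a Young diagram. -/
def addable (S : Finset Box) (t : Box) : Prop :=
  t ∉ S ∧ (t.1 = 0 ∨ (t.1 - 1, t.2) ∈ S) ∧ (t.2 = 0 ∨ (t.1, t.2 - 1) ∈ S)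

/-- Outer corners `O_S`: addable boxes (these all satisfy the bounds used below). -/
noncomputable def Outer (S : Finset Box) : Finset Box :=
  ((Finset.range (S.sup Prod.fst + 2)) ×ˢ (Finset.range (S.sup Prod.snd + 2))).filter
    fun t => addable S t

/-- `I⁺_S = {s + (1,1) : s ∈ I_S}`. -/
noncomputable def Iplus (S : Finset Box) : Finset Box :=
  (Inner S).image fun s => (s.1 + 1, s.2 + 1)

/-- `R^s_S` : boxes of `S` in the same row as `s`. -/
def rowOf (S : Finset Box) (s : Box) : Finset Box := S.filter fun b => b.2 = s.2

/-- `C^s_S` : boxes of `S` in the same column as `s`. -/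
def colOf (S : Finset Box) (s : Box) : Finset Box := S.filter fun b => b.1 = s.1

/-- `a ∧ b := (min a₁ b₁, min a₂ b₂)`. -/
def meet (a b : Box) : Box := (min a.1 b.1, min a.2 b.2)

/-- Pole order of `f` at `u = c`: multiplicity of `(u − c)` in the denominator minus its
multiplicity in the numerator, `f` being written in lowest terms. -/
noncomputable def polOrder (f : F) (c : K) : ℤ :=
  (f.denom.rootMultiplicity c : ℤ) - (f.num.rootMultiplicity c : ℤ)

/-- `ϖ_S = ∏_{b ∈ S, b ≠ (0,0)} [b]`. -/
noncomputable def varpi (S : Finset Box) : K := ∏ b ∈ S.erase (0, 0), brkN b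


/-- The mixed second difference of `φ`. -/
def mixedDiff {A : Type*} [AddCommGroup A] (φ : ℤ → ℤ → A) (a b : ℤ) : A :=
  φ a b + φ (a - 1) (b - 1) - φ (a - 1) b - φ a (b - 1)

lemma IsYoung.exists_profile {S : Finset Box} (hS : IsYoung S) :
    ∃ L c : ℕ → ℕ, (∀ x y, (x, y) ∈ S ↔ x < L y) ∧ (∀ x y, (x, y) ∈ S ↔ y < c x) ∧
      (∀ x y, arm S (x, y) = L y - (x + 1)) ∧ ∀ x y, leg S (x, y) = c x - (y + 1) := by
  let Y : YoungDiagram := ⟨S, hS⟩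
  have hL : ∀ x y, (x, y) ∈ S ↔ x < Y.colLen y := fun x y => YoungDiagram.mem_iff_lt_colLen (μ := Y)
  have hc : ∀ x y, (x, y) ∈ S ↔ y < Y.rowLen x := fun x y => YoungDiagram.mem_iff_lt_rowLen (μ := Y)
  refine ⟨Y.colLen, Y.rowLen, hL, hc, fun x y => ?_, fun x y => ?_⟩
  · have : S.filter (fun b => b.2 = y ∧ x < b.1) =
        (Finset.Ico (x + 1) (Y.colLen y)).image fun a => (a, y) := by
      ext ⟨a, b⟩
      simp only [Finset.mem_filter, hL, Finset.mem_image, Finset.mem_Ico, Prod.mk.injEq]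
      constructor
      · rintro ⟨h1, rfl, h2⟩
        exact ⟨a, ⟨h2, h1⟩, rfl, rfl⟩
      · rintro ⟨a', ⟨h1, h2⟩, rfl, rfl⟩
        exact ⟨h2, rfl, h1⟩
    rw [arm, this, Finset.card_image_of_injective _ (fun a a' h => (Prod.mk.inj h).1),
      Nat.card_Ico]
  · have : S.filter (fun b => b.1 = x ∧ y < b.2) =
        (Finset.Ico (y + 1) (Y.rowLen x)).image fun a => (x, a) := by
      ext ⟨a, b⟩
      simp only [Finset.mem_filter, hc, Finset.mem_image, Finset.mem_Ico, Prod.mk.injEq]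
      constructor
      · rintro ⟨h1, rfl, h2⟩
        exact ⟨b, ⟨h2, h1⟩, rfl, rfl⟩
      · rintro ⟨a', ⟨h1, h2⟩, rfl, rfl⟩
        exact ⟨h2, rfl, h1⟩
    rw [leg, this, Finset.card_image_of_injective _ (fun a a' h => (Prod.mk.inj h).2),
      Nat.card_Ico]

section Telescoping

variable {A : Type*} [AddCommGroup A] (φ : ℤ → ℤ → A)

lemma sum_mixedDiff_add (p q : ℤ) (k : ℕ) :
    ∑ a ∈ Finset.range k, mixedDiff φ (a - p) q =
      φ (k - 1 - p) q - φ (k - 1 - p) (q - 1) - (φ (-1 - p) q - φ (-1 - p) (q - 1)) := by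
  induction k with
  | zero => simp
  | succ k ih =>
    rw [Finset.sum_range_succ, ih, mixedDiff]
    have h1 : ((k + 1 : ℕ) : ℤ) - 1 - p = k - p := by push_cast; ring
    have h2 : (k : ℤ) - p - 1 = k - 1 - p := by ring
    rw [h1, h2]
    abel

lemma sum_mixedDiff_sub (p q : ℤ) (k : ℕ) :
    ∑ a ∈ Finset.range k, mixedDiff φ (p - a) q =
      φ p q - φ p (q - 1) - (φ (p - k) q - φ (p - k) (q - 1)) := by
  induction k with
  | zero => simp
  | succ k ih =>
    rw [Finset.sum_range_succ, ih, mixedDiff]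
    have h1 : p - ((k + 1 : ℕ) : ℤ) = p - k - 1 := by push_cast; ring
    rw [h1]
    abel

lemma sum_mixedDiff_rect (m n : ℕ) (p q : ℤ) :
    ∑ t ∈ rect m n, mixedDiff φ (t.1 - p) (t.2 - q) =
      φ (m - 1 - p) (n - 1 - q) + φ (-1 - p) (-1 - q) - φ (m - 1 - p) (-1 - q)
        - φ (-1 - p) (n - 1 - q) := by
  rw [rect, Finset.sum_product_right]
  simp only [sum_mixedDiff_add]
  induction n with
  | zero => simp
  | succ n ih =>
    rw [Finset.sum_range_succ, ih]
    have h1 : ((n + 1 : ℕ) : ℤ) - 1 - q = n - q := by push_cast; ring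
    have h2 : (n : ℤ) - q - 1 = n - 1 - q := by ring
    rw [h1, h2]
    abel

lemma sum_sub_pred (g : ℤ → A) (a : ℤ) (k : ℕ) :
    ∑ i ∈ Finset.range k, (g (a + i) - g (a + i - 1)) = g (a + k - 1) - g (a - 1) := by
  induction k with
  | zero => simp
  | succ k ih =>
    rw [Finset.sum_range_succ, ih]
    have h1 : a + ((k + 1 : ℕ) : ℤ) - 1 = a + k := by push_cast; ring
    rw [h1]
    abel

lemma sum_sub_pred_neg (g : ℤ → A) (a : ℤ) (k : ℕ) :
    ∑ i ∈ Finset.range k, (g (a - i) - g (a - i - 1)) = g a - g (a - k) := by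
  induction k with
  | zero => simp
  | succ k ih =>
    rw [Finset.sum_range_succ, ih]
    have h1 : a - ((k + 1 : ℕ) : ℤ) = a - k - 1 := by push_cast; ring
    rw [h1]
    abel

lemma IsYoung.sum_below {S : Finset Box} (hS : IsYoung S) (H : ℕ → ℕ → ℕ → A) :
    ∑ t ∈ S, ∑ y ∈ Finset.range t.2, H t.1 t.2 y =
      ∑ b ∈ S, ∑ k ∈ Finset.range (leg S b), H b.1 (b.2 + 1 + k) b.2 := by
  obtain ⟨L, c, -, hc, -, hleg⟩ := hS.exists_profile
  rw [Finset.sum_sigma', Finset.sum_sigma']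
  refine Finset.sum_nbij' (fun p => ⟨(p.1.1, p.2), p.1.2 - (p.2 + 1)⟩)
    (fun p => ⟨(p.1.1, p.1.2 + 1 + p.2), p.1.2⟩) ?_ ?_ ?_ ?_ ?_
  · rintro ⟨⟨x, y⟩, k⟩
    simp only [Finset.mem_sigma, hc, Finset.mem_range, hleg]
    omega
  · rintro ⟨⟨x, y⟩, k⟩
    simp only [Finset.mem_sigma, hc, Finset.mem_range, hleg]
    omega
  · rintro ⟨⟨x, y⟩, k⟩
    simp only [Finset.mem_sigma, Finset.mem_range]
    rintro ⟨-, h⟩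
    have : k + 1 + (y - (k + 1)) = y := by omega
    rw [this]
  · rintro ⟨⟨x, y⟩, k⟩ -
    have : y + 1 + k - (y + 1) = k := by omega
    simp only [this]
  · rintro ⟨⟨x, y⟩, k⟩
    simp only [Finset.mem_sigma, Finset.mem_range]
    rintro ⟨-, h⟩
    have : k + 1 + (y - (k + 1)) = y := by omega
    rw [this]

lemma IsYoung.sum_row_reflect {S : Finset Box} (hS : IsYoung S) (g : ℕ → A) :
    ∑ b ∈ S, g (arm S b) = ∑ b ∈ S, g b.1 := by
  obtain ⟨L, c, hL, -, harm, -⟩ := hS.exists_profile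
  refine Finset.sum_nbij' (fun b => (arm S b, b.2)) (fun b => (arm S b, b.2)) ?_ ?_ ?_ ?_
    (fun _ _ => rfl) <;>
    rintro ⟨x, y⟩ <;> simp only [hL, harm, Prod.mk.injEq, and_true] <;> omega

/-- The character identity for the tangent space at a monomial ideal, evaluated on `φ`. -/
lemma IsYoung.sum_mixedDiff {S : Finset Box} (hS : IsYoung S) :
    ∑ s ∈ S, ∑ t ∈ S, mixedDiff φ (t.1 - s.1) (t.2 - s.2) =
      ∑ s ∈ S, (φ s.1 s.2 + φ (-1 - s.1) (-1 - s.2) - φ (-(arm S s + 1)) (leg S s)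
        - φ (arm S s) (-(leg S s + 1))) := by
  obtain ⟨L, c, hL, hc, harm, hleg⟩ := hS.exists_profile
  have hrow : ∀ (k : ℕ) (F : Box → A), ∑ s ∈ S.filter (fun s => s.2 < k), F s =
      ∑ y ∈ Finset.range k, ∑ x ∈ Finset.range (L y), F (x, y) := fun k F =>
    Finset.sum_finset_product_right _ _ _ (by
      rintro ⟨x, y⟩
      simp only [Finset.mem_filter, hL, Finset.mem_range, and_comm])
  have hsplit : ∑ s ∈ S, ∑ t ∈ S, mixedDiff φ (t.1 - s.1) (t.2 - s.2) =
      ∑ t ∈ S, ∑ s ∈ S.filter (fun s => s.2 < t.2 + 1), mixedDiff φ (t.1 - s.1) (t.2 - s.2) +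
      ∑ s ∈ S, ∑ t ∈ S.filter (fun t => t.2 < s.2), mixedDiff φ (t.1 - s.1) (t.2 - s.2) := by
    have h1 : ∑ t ∈ S, ∑ s ∈ S.filter (fun s => s.2 < t.2 + 1),
        mixedDiff φ (t.1 - s.1) (t.2 - s.2) =
        ∑ s ∈ S, ∑ t ∈ S.filter (fun t => ¬ t.2 < s.2), mixedDiff φ (t.1 - s.1) (t.2 - s.2) := by
      apply Finset.sum_comm'
      intro s t
      simp only [Finset.mem_filter]
      constructor
      · rintro ⟨h1, h2, h3⟩
        exact ⟨⟨h1, by omega⟩, h2⟩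
      · rintro ⟨⟨h1, h2⟩, h3⟩
        exact ⟨h1, h3, by omega⟩
    rw [h1, ← Finset.sum_add_distrib]
    refine Finset.sum_congr rfl fun s _ => ?_
    rw [add_comm, Finset.sum_filter_add_sum_filter_not]
  have hup : ∑ t ∈ S, ∑ s ∈ S.filter (fun s => s.2 < t.2 + 1),
      mixedDiff φ (t.1 - s.1) (t.2 - s.2) =
      ∑ s ∈ S, (φ s.1 s.2 - φ s.1 (-1) - φ (-(arm S s + 1)) (leg S s)
        + φ (-(arm S s + 1)) (-1)) := by
    have h1 : ∀ t ∈ S, ∑ s ∈ S.filter (fun s => s.2 < t.2 + 1),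
        mixedDiff φ (t.1 - s.1) (t.2 - s.2) =
        (φ t.1 t.2 - φ t.1 (-1)) - (φ (t.1 - L t.2) 0 - φ (t.1 - L t.2) (-1)) -
          ∑ y ∈ Finset.range t.2,
            (φ (t.1 - L y) (t.2 - y) - φ (t.1 - L y) (t.2 - y - 1)) := by
      intro t _
      rw [hrow]
      simp only [sum_mixedDiff_sub]
      rw [Finset.sum_sub_distrib, sum_sub_pred_neg (φ t.1) t.2 (t.2 + 1), Finset.sum_range_succ]
      have e1 : (t.2 : ℤ) - ((t.2 + 1 : ℕ) : ℤ) = -1 := by push_cast; ring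
      have e2 : (t.2 : ℤ) - t.2 - 1 = -1 := by ring
      rw [e1, e2, sub_self]
      abel
    rw [Finset.sum_congr rfl h1, Finset.sum_sub_distrib,
      hS.sum_below (fun x y' y => φ (x - L y) (y' - y) - φ (x - L y) (y' - y - 1)),
      ← Finset.sum_sub_distrib]
    refine Finset.sum_congr rfl ?_
    rintro ⟨x, y⟩ hxy
    have h2 : ∑ k ∈ Finset.range (leg S (x, y)),
        (φ (x - L y) (((y + 1 + k : ℕ) : ℤ) - y) - φ (x - L y) (((y + 1 + k : ℕ) : ℤ) - y - 1)) =
        φ (x - L y) (1 + leg S (x, y) - 1) - φ (x - L y) (1 - 1) := by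
      rw [← sum_sub_pred (φ (x - L y))]
      refine Finset.sum_congr rfl fun k _ => ?_
      have : ((y + 1 + k : ℕ) : ℤ) - y = 1 + k := by push_cast; ring
      rw [this]
    have e1 : (x : ℤ) - L y = -(arm S (x, y) + 1) := by
      rw [hL] at hxy
      rw [harm]
      omega
    dsimp only
    rw [h2, e1, add_sub_cancel_left, sub_self]
    abel
  have hdown : ∑ s ∈ S, ∑ t ∈ S.filter (fun t => t.2 < s.2),
      mixedDiff φ (t.1 - s.1) (t.2 - s.2) =
      ∑ s ∈ S, (φ (-1 - s.1) (-1 - s.2) - φ (-1 - s.1) (-1) + φ (arm S s) (-1)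
        - φ (arm S s) (-(leg S s + 1))) := by
    have h1 : ∀ s ∈ S, ∑ t ∈ S.filter (fun t => t.2 < s.2),
        mixedDiff φ (t.1 - s.1) (t.2 - s.2) =
        ∑ y ∈ Finset.range s.2,
            (φ (L y - 1 - s.1) (y - s.2) - φ (L y - 1 - s.1) (y - s.2 - 1)) -
          (φ (-1 - s.1) (-1) - φ (-1 - s.1) (-1 - s.2)) := by
      intro s _
      rw [hrow]
      simp only [sum_mixedDiff_add]
      rw [Finset.sum_sub_distrib]
      have := sum_sub_pred (φ (-1 - s.1)) (-s.2) s.2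
      have e1 : -(s.2 : ℤ) + s.2 - 1 = -1 := by ring
      have e2 : -(s.2 : ℤ) - 1 = -1 - s.2 := by ring
      have e3 : ∀ i : ℤ, -(s.2 : ℤ) + i = i - s.2 := fun i => by ring
      rw [e1, e2] at this
      simp only [e3] at this
      rw [this]
    rw [Finset.sum_congr rfl h1, Finset.sum_sub_distrib,
      hS.sum_below (fun x y' y => φ (L y - 1 - x) (y - y') - φ (L y - 1 - x) (y - y' - 1)),
      ← Finset.sum_sub_distrib]
    refine Finset.sum_congr rfl ?_
    rintro ⟨x, y⟩ hxy
    have h2 : ∑ k ∈ Finset.range (leg S (x, y)),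
        (φ (L y - 1 - x) (y - ((y + 1 + k : ℕ) : ℤ)) -
          φ (L y - 1 - x) (y - ((y + 1 + k : ℕ) : ℤ) - 1)) =
        φ (L y - 1 - x) (-1) - φ (L y - 1 - x) (-1 - leg S (x, y)) := by
      rw [← sum_sub_pred_neg (φ (L y - 1 - x))]
      refine Finset.sum_congr rfl fun k _ => ?_
      have : y - ((y + 1 + k : ℕ) : ℤ) = -1 - k := by push_cast; ring
      rw [this]
    have e1 : (L y : ℤ) - 1 - x = arm S (x, y) := by
      rw [hL] at hxy
      rw [harm]
      omega
    have e2 : -1 - (leg S (x, y) : ℤ) = -(leg S (x, y) + 1) := by ring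
    dsimp only
    rw [h2, e1, e2]
    abel
  have hr1 := hS.sum_row_reflect fun a => φ (-1 - a) (-1)
  have hr2 := hS.sum_row_reflect fun a => φ a (-1)
  have e : ∀ a : ℕ, -((a : ℤ) + 1) = -1 - a := fun a => by ring
  rw [hsplit, hup, hdown]
  simp only [Finset.sum_add_distrib, Finset.sum_sub_distrib, e] at hr1 hr2 ⊢
  rw [hr1, hr2]
  abel

end Telescoping

section Complement

variable {m n : ℕ} {S : Finset Box}

lemma mem_rect {b : Box} : b ∈ rect m n ↔ b.1 < m ∧ b.2 < n := by
  simp [rect]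

lemma mem_complIn {b : Box} :
    b ∈ complIn m n S ↔ b ∈ rect m n ∧ conjBox m n b ∉ S := by
  simp only [complIn, Finset.mem_image, Finset.mem_sdiff, mem_rect]
  constructor
  · rintro ⟨⟨x, y⟩, ⟨⟨h1, h2⟩, h3⟩, rfl⟩
    simp only [conjBox] at *
    refine ⟨by omega, ?_⟩
    have e1 : m - 1 - (m - 1 - x) = x := by omega
    have e2 : n - 1 - (n - 1 - y) = y := by omega
    rwa [e1, e2]
  · rcases b with ⟨x, y⟩
    rintro ⟨⟨h1, h2⟩, h3⟩
    simp only [conjBox] at *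
    refine ⟨(m - 1 - x, n - 1 - y), ⟨by omega, h3⟩, ?_⟩
    simp only [Prod.mk.injEq]
    omega

lemma conjBox_conjBox {b : Box} (hb : b ∈ rect m n) : conjBox m n (conjBox m n b) = b := by
  rw [mem_rect] at hb
  ext <;> simp only [conjBox] <;> omega

lemma conjBox_mem_rect {b : Box} (hb : b ∈ rect m n) : conjBox m n b ∈ rect m n := by
  rw [mem_rect] at *
  simp only [conjBox]
  omega

lemma complIn_complIn (hS : S ⊆ rect m n) : complIn m n (complIn m n S) = S := by
  ext b
  rw [mem_complIn, mem_complIn]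
  constructor
  · rintro ⟨h1, h2⟩
    by_contra h
    exact h2 ⟨conjBox_mem_rect h1, by rwa [conjBox_conjBox h1]⟩
  · intro h
    refine ⟨hS h, fun h' => h'.2 ?_⟩
    rwa [conjBox_conjBox (hS h)]

lemma complIn_subset : complIn m n S ⊆ rect m n := fun _ hb => (mem_complIn.1 hb).1

lemma IsYoung.complIn (hS : IsYoung S) : IsYoung (complIn m n S) := by
  intro a b hba ha
  simp only [Finset.mem_coe, mem_complIn, mem_rect] at *
  have h1 := hba.1
  have h2 := hba.2
  refine ⟨by omega, fun h => ha.2 (hS (a := conjBox m n b) ?_ h)⟩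
  exact ⟨by simp only [conjBox]; omega, by simp only [conjBox]; omega⟩

variable {A : Type*} [AddCommGroup A] (φ : ℤ → ℤ → A)

lemma sum_complIn (hS : S ⊆ rect m n) (G : ℤ → ℤ → A) :
    ∑ t ∈ complIn m n S, G (m - 1 - t.1) (n - 1 - t.2) =
      ∑ t ∈ rect m n, G t.1 t.2 - ∑ t ∈ S, G t.1 t.2 := by
  rw [← Finset.sum_sdiff hS, add_sub_cancel_right, JackLR.complIn, Finset.sum_image]
  · refine Finset.sum_congr rfl fun t ht => ?_
    have := mem_rect.1 (Finset.mem_sdiff.1 ht).1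
    congr 1 <;> simp only [conjBox] <;> omega
  · intro a ha b hb hab
    rw [← conjBox_conjBox (Finset.mem_sdiff.1 ha).1, hab,
      conjBox_conjBox (Finset.mem_sdiff.1 hb).1]

lemma IsYoung.sum_mixedDiff_complIn (hS : IsYoung S) (hsub : S ⊆ rect m n) :
    ∑ s ∈ S, ∑ t ∈ JackLR.complIn m n S, mixedDiff φ (m - 1 - t.1 - s.1) (n - 1 - t.2 - s.2) =
      ∑ s ∈ S, (φ (m - 1 - s.1) (n - 1 - s.2) - φ s.1 s.2 - φ (-1 - s.1) (n - 1 - s.2)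
        + φ (-(arm S s + 1)) (leg S s)) +
      ∑ s ∈ S, (φ (arm S s) (-(leg S s + 1)) - φ (m - 1 - s.1) (-1 - s.2)) := by
  have h1 : ∀ s ∈ S, ∑ t ∈ JackLR.complIn m n S,
      mixedDiff φ (m - 1 - t.1 - s.1) (n - 1 - t.2 - s.2) =
      φ (m - 1 - s.1) (n - 1 - s.2) + φ (-1 - s.1) (-1 - s.2) - φ (m - 1 - s.1) (-1 - s.2)
        - φ (-1 - s.1) (n - 1 - s.2) - ∑ t ∈ S, mixedDiff φ (t.1 - s.1) (t.2 - s.2) := by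
    intro s _
    rw [sum_complIn hsub (fun a b => mixedDiff φ (a - s.1) (b - s.2)), sum_mixedDiff_rect]
  rw [Finset.sum_congr rfl h1, Finset.sum_sub_distrib, hS.sum_mixedDiff]
  simp only [← Finset.sum_add_distrib, ← Finset.sum_sub_distrib]
  exact Finset.sum_congr rfl fun s _ => by abel

/-- Lower hooks of a partition and of its complement in a rectangle. -/
lemma IsYoung.sum_lower_hooks_complIn (hS : IsYoung S) (hsub : S ⊆ rect m n) :
    ∑ s ∈ S, (φ (arm S s) (-(leg S s + 1)) - φ (m - 1 - s.1) (-1 - s.2)) =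
      ∑ s ∈ JackLR.complIn m n S, (φ (arm (JackLR.complIn m n S) s)
        (-(leg (JackLR.complIn m n S) s + 1)) - φ (m - 1 - s.1) (-1 - s.2)) := by
  let φ' : ℤ → ℤ → A := fun a b => if b < 0 then φ a b else 0
  have key : ∀ T : Finset Box, T ⊆ rect m n →
      ∑ s ∈ T, (φ' (m - 1 - s.1) (n - 1 - s.2) - φ' s.1 s.2 - φ' (-1 - s.1) (n - 1 - s.2)
        + φ' (-(arm T s + 1)) (leg T s)) +
      ∑ s ∈ T, (φ' (arm T s) (-(leg T s + 1)) - φ' (m - 1 - s.1) (-1 - s.2)) =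
      ∑ s ∈ T, (φ (arm T s) (-(leg T s + 1)) - φ (m - 1 - s.1) (-1 - s.2)) := by
    intro T hT
    rw [← Finset.sum_add_distrib]
    refine Finset.sum_congr rfl fun s hs => ?_
    have := mem_rect.1 (hT hs)
    simp only [φ']
    rw [if_neg (by omega), if_neg (by omega), if_neg (by omega), if_neg (by omega),
      if_pos (by omega), if_pos (by omega)]
    abel
  rw [← key S hsub, ← key _ complIn_subset, ← hS.sum_mixedDiff_complIn φ' hsub,
    ← hS.complIn.sum_mixedDiff_complIn φ' complIn_subset, complIn_complIn hsub, Finset.sum_comm]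
  refine Finset.sum_congr rfl fun s _ => Finset.sum_congr rfl fun t _ => ?_
  congr 1 <;> ring

end Complement

section Evaluation

/-- `f` is defined at `c` and takes the value `k` there. -/
def HasValueAt (c : K) (f : F) (k : K) : Prop :=
  f.denom.eval c ≠ 0 ∧ RatFunc.eval (RingHom.id K) c f = k

variable {c k l : K} {f g : F}

lemma hasValueAt_div {p q : Polynomial K} (hq : q.eval c ≠ 0) :
    HasValueAt c (algebraMap (Polynomial K) F p / algebraMap (Polynomial K) F q)
      (p.eval c / q.eval c) := by
  have hq0 : q ≠ 0 := by
    rintro rfl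
    simp at hq
  have hd : (algebraMap (Polynomial K) F p / algebraMap (Polynomial K) F q).denom.eval c ≠ 0 :=
    fun h => hq (Polynomial.eval_eq_zero_of_dvd_of_eval_eq_zero (RatFunc.denom_div_dvd p q) h)
  refine ⟨hd, ?_⟩
  have hqF : algebraMap (Polynomial K) F q ≠ 0 := RatFunc.algebraMap_ne_zero hq0
  have hmul : RatFunc.eval (RingHom.id K) c
        (algebraMap (Polynomial K) F p / algebraMap (Polynomial K) F q) *
      RatFunc.eval (RingHom.id K) c (algebraMap (Polynomial K) F q) =
      RatFunc.eval (RingHom.id K) c (algebraMap (Polynomial K) F p) := by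
    rw [← RatFunc.eval_mul (RingHom.id K) c hd (by simp), div_mul_cancel₀ _ hqF]
  rw [RatFunc.eval_algebraMap, RatFunc.eval_algebraMap] at hmul
  exact eq_div_of_mul_eq hq hmul

lemma HasValueAt.exists_div (h : HasValueAt c f k) : ∃ p q : Polynomial K, q.eval c ≠ 0 ∧
    f = algebraMap (Polynomial K) F p / algebraMap (Polynomial K) F q ∧
    k = p.eval c / q.eval c :=
  ⟨f.num, f.denom, h.1, (RatFunc.num_div_denom f).symm, h.2.symm⟩

lemma HasValueAt.mul (hf : HasValueAt c f k) (hg : HasValueAt c g l) :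
    HasValueAt c (f * g) (k * l) := by
  obtain ⟨p, q, hq, rfl, rfl⟩ := hf.exists_div
  obtain ⟨p', q', hq', rfl, rfl⟩ := hg.exists_div
  have := hasValueAt_div (c := c) (p := p * p') (q := q * q')
    (by rw [Polynomial.eval_mul]; exact mul_ne_zero hq hq')
  rwa [map_mul, map_mul, Polynomial.eval_mul, Polynomial.eval_mul, mul_div_mul_comm,
    mul_div_mul_comm] at this

lemma HasValueAt.inv (hf : HasValueAt c f k) (hk : k ≠ 0) : HasValueAt c f⁻¹ k⁻¹ := by
  obtain ⟨p, q, hq, rfl, rfl⟩ := hf.exists_div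
  rw [inv_div, inv_div]
  exact hasValueAt_div fun h => hk (by rw [h, zero_div])

lemma HasValueAt.div (hf : HasValueAt c f k) (hg : HasValueAt c g l) (hl : l ≠ 0) :
    HasValueAt c (f / g) (k / l) := by
  rw [div_eq_mul_inv, div_eq_mul_inv]
  exact hf.mul (hg.inv hl)

lemma HasValueAt.prod {ι : Type*} {s : Finset ι} {f : ι → F} {k : ι → K}
    (h : ∀ i ∈ s, HasValueAt c (f i) (k i)) :
    HasValueAt c (∏ i ∈ s, f i) (∏ i ∈ s, k i) := by
  induction s using Finset.cons_induction with
  | empty =>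
    have := hasValueAt_div (c := c) (p := 1) (q := 1) (by simp)
    simpa using this
  | cons a s ha ih =>
    rw [Finset.prod_cons, Finset.prod_cons]
    exact (h a (Finset.mem_cons_self a s)).mul
      (ih fun i hi => h i (Finset.mem_cons_of_mem hi))

lemma hasValueAt_X_sub_C (c d : K) : HasValueAt c (uu - RatFunc.C d) (c - d) := by
  have := hasValueAt_div (c := c) (p := Polynomial.X - Polynomial.C d) (q := 1) (by simp)
  simpa [uu] using this

lemma uu_sub_C_ne_zero (d : K) : uu - RatFunc.C d ≠ 0 := by
  have : uu - RatFunc.C d = algebraMap (Polynomial K) F (Polynomial.X - Polynomial.C d) := by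
    simp [uu]
  rw [this]
  exact RatFunc.algebraMap_ne_zero (Polynomial.X_sub_C_ne_zero d)

lemma brk_ne_zero {a b : ℤ} (h : ¬(a = 0 ∧ b = 0)) : brk (a, b) ≠ 0 := by
  have e : brk (a, b) = algebraMap (Polynomial ℚ) K
      (Polynomial.C (a : ℚ) * Polynomial.X - Polynomial.C (b : ℚ)) := by
    simp [brk, alpha, mul_comm]
  rw [e]
  refine RatFunc.algebraMap_ne_zero fun h0 => h ⟨?_, ?_⟩
  · have h1 := congrArg (fun p => p.coeff 1) h0
    simp only [Polynomial.coeff_sub, Polynomial.coeff_C_mul, Polynomial.coeff_X_one,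
      Polynomial.coeff_C_of_ne_zero one_ne_zero, Polynomial.coeff_zero, mul_one, sub_zero] at h1
    exact_mod_cast h1
  · simpa using congrArg (fun p => p.coeff 0) h0

lemma isYoung_rect (m n : ℕ) : IsYoung (rect m n) := by
  intro a b hba ha
  simp only [Finset.mem_coe, mem_rect] at *
  exact ⟨hba.1.trans_lt ha.1, hba.2.trans_lt ha.2⟩

lemma arm_rect {m n : ℕ} {b : Box} (hb : b ∈ rect m n) :
    (arm (rect m n) b : ℤ) = m - 1 - b.1 := by
  obtain ⟨L, c, hL, -, harm, -⟩ := (isYoung_rect m n).exists_profile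
  obtain ⟨x, y⟩ := b
  have h1 := hL m y
  have h2 := hL (m - 1) y
  rw [mem_rect] at h1 h2 hb
  rw [harm]
  dsimp only at *
  omega

lemma leg_rect {m n : ℕ} {b : Box} (hb : b ∈ rect m n) :
    (leg (rect m n) b : ℤ) = n - 1 - b.2 := by
  obtain ⟨L, c, -, hc, -, hleg⟩ := (isYoung_rect m n).exists_profile
  obtain ⟨x, y⟩ := b
  have h1 := hc x n
  have h2 := hc x (n - 1)
  rw [mem_rect] at h1 h2 hb
  rw [hleg]
  dsimp only at *
  omega

lemma lh_rect_vflip {m n : ℕ} {b : Box} (hb : b ∈ rect m n) :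
    lh (rect m n) (vflip n b) = brk (m - 1 - b.1, -1 - b.2) := by
  have hb' := mem_rect.1 hb
  have hv : vflip n b ∈ rect m n := by
    rw [mem_rect]
    simp only [vflip]
    omega
  rw [lh, hlo, arm_rect hv, leg_rect hv]
  congr 2
  simp only [vflip]
  omega

lemma uh_rect_hflip {m n : ℕ} {b : Box} (hb : b ∈ rect m n) :
    uh (rect m n) (hflip m b) = -brk (-1 - b.1, n - 1 - b.2) := by
  have hb' := mem_rect.1 hb
  have hv : hflip m b ∈ rect m n := by
    rw [mem_rect]
    simp only [hflip]
    omega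
  have h1 : ((m - 1 - b.1 : ℕ) : ℤ) = m - 1 - b.1 := by omega
  rw [uh, hup, arm_rect hv, leg_rect hv]
  simp only [hflip, h1, brk]
  push_cast
  ring

lemma lh_eq (S : Finset Box) (b : Box) : lh S b = brk (arm S b, -(leg S b + 1)) := rfl

lemma uh_eq (S : Finset Box) (b : Box) : uh S b = -brk (-(arm S b + 1), leg S b) := by
  simp only [uh, hup, brk]
  push_cast
  ring

end Evaluation

section Linear

/-- The linear factor `u - [v⁻] + [(a, b)]`. -/
noncomputable def shiftedLin (v : Box) (a b : ℤ) : F :=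
  uu - RatFunc.C (brkN v - brk (a, b))

lemma shiftedLin_ne_zero (v : Box) (a b : ℤ) : shiftedLin v a b ≠ 0 := uu_sub_C_ne_zero _

/-- `shiftedLin` as an additively written unit. -/
noncomputable def shiftedUnit (v : Box) (a b : ℤ) : Additive Fˣ :=
  Additive.ofMul (Units.mk0 _ (shiftedLin_ne_zero v a b))

/-- The underlying rational function of an additively written unit. -/
noncomputable def unitVal (x : Additive Fˣ) : F := ((Additive.toMul x : Fˣ) : F)

lemma unitVal_shiftedUnit (v : Box) (a b : ℤ) :
    unitVal (shiftedUnit v a b) = shiftedLin v a b := rfl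

lemma unitVal_add (x y : Additive Fˣ) : unitVal (x + y) = unitVal x * unitVal y := rfl

lemma unitVal_sub (x y : Additive Fˣ) : unitVal (x - y) = unitVal x / unitVal y := by
  simp [unitVal]

lemma unitVal_sum {ι : Type*} (s : Finset ι) (x : ι → Additive Fˣ) :
    unitVal (∑ i ∈ s, x i) = ∏ i ∈ s, unitVal (x i) := by
  simp [unitVal, toMul_sum]

lemma hasValueAt_shiftedLin (v : Box) (a b : ℤ) :
    HasValueAt (brkN v) (shiftedLin v a b) (brk (a, b)) := by
  have := hasValueAt_X_sub_C (brkN v) (brkN v - brk (a, b))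
  rwa [sub_sub_cancel] at this

lemma unitVal_mixedDiff (v s t : Box) :
    unitVal (mixedDiff (shiftedUnit v) (v.1 - t.1 - s.1) (v.2 - t.2 - s.2)) =
      Tbox (uu - RatFunc.C (brkN (s.1 + t.1, s.2 + t.2))) := by
  have h : ∀ a b : ℤ, uu - RatFunc.C (brkN (s.1 + t.1, s.2 + t.2)) - RatFunc.C (brk (a, b)) =
      shiftedLin v (v.1 - t.1 - s.1 - a) (v.2 - t.2 - s.2 - b) := by
    intro a b
    rw [shiftedLin, sub_sub, ← map_add]
    congr 2
    simp only [brkN, zb, brk]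
    push_cast
    ring
  rw [Tbox, h, h, h, h, mixedDiff, unitVal_sub, unitVal_sub, unitVal_add, div_div]
  simp only [unitVal_shiftedUnit, sub_zero]

lemma TM_star (v : Box) (S C : Finset Box) :
    TM (star S C) = unitVal (∑ s ∈ S, ∑ t ∈ C,
      mixedDiff (shiftedUnit v) (v.1 - t.1 - s.1) (v.2 - t.2 - s.2)) := by
  simp only [unitVal_sum, unitVal_mixedDiff]
  rw [TM, TMat, star, Multiset.map_bind, Multiset.prod_bind]
  simp only [Multiset.map_map, Function.comp_def]
  rfl

end Linear

/-- The residue of `T_{μ*μ̄}` at `u = [v⁻]`, i.e. the value of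
`(u − [v⁻])·T_{μ*μ̄}(u)` at `u = [v⁻]`, as a product of hook ratios. -/
theorem stmt2 (m n : ℕ) (hm : 1 ≤ m) (hn : 1 ≤ n) (μ : Finset Box)
    (hμ : IsYoung μ) (hsub : μ ⊆ rect m n) (hne : μ.Nonempty) :
    (((uu - RatFunc.C (brkN (vminus m n))) * TM (star μ (complIn m n μ))).denom.eval
        (brkN (vminus m n)) ≠ 0) ∧
    RatFunc.eval (RingHom.id K) (brkN (vminus m n))
        ((uu - RatFunc.C (brkN (vminus m n))) * TM (star μ (complIn m n μ))) =
      ((∏ b ∈ μ, brkN (conjBox m n b)) / (∏ b ∈ μ.erase (0, 0), brkN b)) *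
        (∏ b ∈ complIn m n μ, lh (complIn m n μ) b / lh (rect m n) (vflip n b)) *
        (∏ b ∈ μ, uh μ b / uh (rect m n) (hflip m b)) := by
  change HasValueAt _ _ _
  set v := vminus m n with hv
  have hv1 : (v.1 : ℤ) = m - 1 := by simp only [hv, vminus]; omega
  have hv2 : (v.2 : ℤ) = n - 1 := by simp only [hv, vminus]; omega
  have h0 : ((0, 0) : Box) ∈ μ := by
    obtain ⟨b, hb⟩ := hne
    exact hμ (a := b) (b := (0, 0)) ⟨Nat.zero_le _, Nat.zero_le _⟩ hb
  have hlin : uu - RatFunc.C (brkN v) = unitVal (shiftedUnit v 0 0) := by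
    rw [unitVal_shiftedUnit, shiftedLin]
    simp [brk]
  have key : (uu - RatFunc.C (brkN v)) * TM (star μ (complIn m n μ)) =
      ((∏ b ∈ μ, shiftedLin v (m - 1 - b.1) (n - 1 - b.2)) /
          (∏ b ∈ μ.erase (0, 0), shiftedLin v b.1 b.2)) *
        (∏ b ∈ complIn m n μ, shiftedLin v (arm (complIn m n μ) b) (-(leg (complIn m n μ) b + 1)) /
          shiftedLin v (m - 1 - b.1) (-1 - b.2)) *
        (∏ b ∈ μ, shiftedLin v (-(arm μ b + 1)) (leg μ b) /
          shiftedLin v (-1 - b.1) (n - 1 - b.2)) := by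
    rw [hlin, TM_star v, hv1, hv2, hμ.sum_mixedDiff_complIn _ hsub,
      hμ.sum_lower_hooks_complIn _ hsub, ← unitVal_add]
    simp only [← unitVal_shiftedUnit, ← unitVal_sub, ← unitVal_sum, ← unitVal_add]
    congr 1
    simp only [Finset.sum_add_distrib, Finset.sum_sub_distrib]
    rw [← Finset.add_sum_erase μ (fun b => shiftedUnit v b.1 b.2) h0]
    simp only [Nat.cast_zero]
    abel
  rw [key]
  refine ((HasValueAt.div (.prod fun b hb => ?_) (.prod fun b hb => ?_) ?_).mul
    (.prod fun b hb => ?_)).mul (.prod fun b hb => ?_)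
  · have hb' := mem_rect.1 (hsub hb)
    have e : brkN (conjBox m n b) = brk (m - 1 - b.1, n - 1 - b.2) := by
      rw [brkN, zb]
      congr 2 <;> simp only [conjBox] <;> omega
    rw [e]
    exact hasValueAt_shiftedLin _ _ _
  · exact hasValueAt_shiftedLin _ _ _
  · refine Finset.prod_ne_zero_iff.2 fun b hb => brk_ne_zero fun h => ?_
    exact Finset.ne_of_mem_erase hb (Prod.ext (by exact_mod_cast h.1) (by exact_mod_cast h.2))
  · rw [lh_rect_vflip (complIn_subset hb), lh_eq]
    exact (hasValueAt_shiftedLin _ _ _).div (hasValueAt_shiftedLin _ _ _)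
      (brk_ne_zero (by omega))
  · rw [uh_rect_hflip (hsub hb), uh_eq, neg_div_neg_eq]
    exact (hasValueAt_shiftedLin _ _ _).div (hasValueAt_shiftedLin _ _ _)
      (brk_ne_zero (by omega))

end JackLR
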